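/- Let C ⊆ F_2^n be a linear code of dimension t. Define, for 1 ≤ k ≤ n, ε_k(C) = 2^n · Pr_C(k) / binom(n,k), where Pr_C(k) = (number of codewords of C with Hamming weight k)/|C|, and ε(C) = max_{1≤k≤n} ε_k(C). Then the permuted code family C_C = {σ(C) : σ ∈ S_n} is an ε(C)-almost universal_2 code family: for every nonzero x ∈ F_2^n, Pr_{σ uniform in S_n}[x ∈ σ(C)] ≤ ε(C)·2^(t-n). In fact Pr_σ[x ∈ σ(C)] = |C|·Pr_C(|x|)/binom(n,|x|) where |x| is the Hamming weight of x. -/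

import Mathlib

open scoped Classical

noncomputable def pr {I : Type*} [Fintype I] (P : I → Prop) : ℝ :=
  ((Finset.univ.filter P).card : ℝ) / (Fintype.card I : ℝ)

/-- Hamming weight. -/
noncomputable def wt {n : ℕ} (x : Fin n → ZMod 2) : ℕ :=
  (Finset.univ.filter (fun i => x i ≠ 0)).card

/-- The bit-permuted code `σ(C) = {x^σ : x ∈ C}` with `(x^σ)_i = x_{σ(i)}`. -/
noncomputable def permCode {n : ℕ} (σ : Equiv.Perm (Fin n))
    (C : Submodule (ZMod 2) (Fin n → ZMod 2)) : Submodule (ZMod 2) (Fin n → ZMod 2) :=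
  C.map (LinearMap.funLeft (ZMod 2) (ZMod 2) σ)

/-- Number of codewords of `C` of Hamming weight `k`. -/
noncomputable def wtCount {n : ℕ} (C : Submodule (ZMod 2) (Fin n → ZMod 2)) (k : ℕ) : ℕ :=
  (Finset.univ.filter (fun c : Fin n → ZMod 2 => c ∈ C ∧ wt c = k)).card

/-- `ε_k(C) = 2^n · Pr_C(k) / binom(n,k)` where `Pr_C(k) = wtCount C k / |C|`. -/
noncomputable def epsK {n : ℕ} (C : Submodule (ZMod 2) (Fin n → ZMod 2)) (k : ℕ) : ℝ :=
  2 ^ n * ((wtCount C k : ℝ) / (Nat.card C : ℝ)) / (Nat.choose n k : ℝ)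

theorem ZMod.two_eq_of_ne_zero_iff {a b : ZMod 2} (h : a ≠ 0 ↔ b ≠ 0) : a = b := by
  revert a b
  decide

theorem wt_comp_perm {n : ℕ} (x : Fin n → ZMod 2) (σ : Equiv.Perm (Fin n)) :
    wt (x ∘ σ) = wt x :=
  Finset.card_equiv σ (by simp)

theorem wt_pos {n : ℕ} {x : Fin n → ZMod 2} (hx : x ≠ 0) : 1 ≤ wt x := by
  obtain ⟨i, hi⟩ := Function.ne_iff.mp hx
  exact Finset.card_pos.mpr ⟨i, by simpa using hi⟩

theorem wt_le {n : ℕ} (x : Fin n → ZMod 2) : wt x ≤ n :=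
  (Finset.card_le_univ _).trans_eq (Fintype.card_fin n)

theorem exists_perm_comp_eq_of_wt_eq {n : ℕ} {x y : Fin n → ZMod 2} (h : wt y = wt x) :
    ∃ τ : Equiv.Perm (Fin n), x ∘ τ = y := by
  have hcard : Fintype.card {i // y i ≠ 0} = Fintype.card {i // x i ≠ 0} := by
    rw [Fintype.card_subtype, Fintype.card_subtype]
    exact h
  let e : {i // y i ≠ 0} ≃ {i // x i ≠ 0} := Fintype.equivOfCardEq hcard
  refine ⟨e.extendSubtype, funext fun i => ZMod.two_eq_of_ne_zero_iff ⟨fun hi => ?_, fun hi => ?_⟩⟩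
  · by_contra hy
    exact e.extendSubtype_not_mem i (not_not.mpr hy) hi
  · exact e.extendSubtype_mem i hi

theorem card_wt_eq (n k : ℕ) :
    (Finset.univ.filter (fun y : Fin n → ZMod 2 => wt y = k)).card = n.choose k := by
  have hcard : (Finset.powersetCard k (Finset.univ : Finset (Fin n))).card = n.choose k := by
    simp
  rw [← hcard]
  refine Finset.card_nbij' (fun y => Finset.univ.filter (fun i => y i ≠ 0))
    (fun s i => if i ∈ s then 1 else 0) ?_ ?_ ?_ ?_
  · intro y hy
    simpa [Finset.mem_powersetCard, wt] using hy
  · intro s hs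
    simpa [Finset.mem_powersetCard, wt] using hs
  · intro y _
    exact funext fun i => ZMod.two_eq_of_ne_zero_iff (by simp)
  · intro s _
    ext i
    simp

/-- The set of permutations carrying `x` to a given word of the same weight has the size of the
stabilizer of `x`. -/
theorem card_perm_comp_symm_eq {n : ℕ} {x y : Fin n → ZMod 2} (h : wt y = wt x) :
    (Finset.univ.filter (fun σ : Equiv.Perm (Fin n) => x ∘ σ.symm = y)).card =
      (Finset.univ.filter (fun σ : Equiv.Perm (Fin n) => x ∘ σ.symm = x)).card := by
  obtain ⟨τ, rfl⟩ := exists_perm_comp_eq_of_wt_eq h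
  refine Finset.card_equiv (Equiv.mulLeft τ) fun σ => ?_
  simp only [Finset.mem_filter, Finset.mem_univ, true_and, Equiv.coe_mulLeft]
  change x ∘ σ.symm = x ∘ τ ↔ (x ∘ σ.symm) ∘ τ.symm = x
  exact (τ.comp_symm_eq x (x ∘ σ.symm)).symm

theorem card_perm_comp_symm_mem {n : ℕ} (x : Fin n → ZMod 2) (P : (Fin n → ZMod 2) → Prop) :
    (Finset.univ.filter (fun σ : Equiv.Perm (Fin n) => P (x ∘ σ.symm))).card =
      (Finset.univ.filter (fun y : Fin n → ZMod 2 => P y ∧ wt y = wt x)).card *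
        (Finset.univ.filter (fun σ : Equiv.Perm (Fin n) => x ∘ σ.symm = x)).card := by
  rw [Finset.card_eq_sum_card_fiberwise (f := fun σ : Equiv.Perm (Fin n) => x ∘ σ.symm)
    (t := Finset.univ.filter (fun y : Fin n → ZMod 2 => P y ∧ wt y = wt x))
    (fun σ hσ => by simpa [wt_comp_perm] using hσ)]
  refine Finset.sum_const_nat fun y hy => ?_
  obtain ⟨hP, hwt⟩ := (Finset.mem_filter.mp hy).2
  rw [← card_perm_comp_symm_eq hwt, Finset.filter_filter]
  congr 1
  ext σ
  simp only [Finset.mem_filter, Finset.mem_univ, true_and, and_iff_right_iff_imp]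
  rintro rfl
  exact hP

theorem mem_permCode_iff {n : ℕ} (σ : Equiv.Perm (Fin n))
    (C : Submodule (ZMod 2) (Fin n → ZMod 2)) (x : Fin n → ZMod 2) :
    x ∈ permCode σ C ↔ x ∘ σ.symm ∈ C := by
  constructor
  · rintro ⟨c, hc, rfl⟩
    simpa [LinearMap.funLeft, Function.comp_assoc] using hc
  · intro h
    exact ⟨x ∘ σ.symm, h, funext fun i => by simp [LinearMap.funLeft_apply]⟩

theorem pr_mem_permCode {n : ℕ} (C : Submodule (ZMod 2) (Fin n → ZMod 2))
    (x : Fin n → ZMod 2) :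
    pr (fun σ : Equiv.Perm (Fin n) => x ∈ permCode σ C) =
      (wtCount C (wt x) : ℝ) / (n.choose (wt x) : ℝ) := by
  have hC := card_perm_comp_symm_mem x (· ∈ C)
  have htotal := card_perm_comp_symm_mem x (fun _ => True)
  simp only [true_and, Finset.filter_true, Finset.card_univ, card_wt_eq] at htotal
  have hstab : (Finset.univ.filter
      (fun σ : Equiv.Perm (Fin n) => x ∘ σ.symm = x)).card ≠ 0 := by
    intro h
    rw [h, mul_zero] at htotal
    exact Fintype.card_ne_zero htotal
  simp only [pr, mem_permCode_iff]
  rw [hC, htotal, Nat.cast_mul, Nat.cast_mul,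
    mul_div_mul_right _ _ (Nat.cast_ne_zero.mpr hstab)]
  rfl

/-- the permuted code family `{σ(C) : σ ∈ S_n}` of a `t`-dimensional code `C`
is `ε(C)`-almost universal₂, where `ε(C) = max_{1≤k≤n} ε_k(C)`; indeed
`Pr_σ[x ∈ σ(C)] = |C|·Pr_C(|x|)/binom(n,|x|)`. -/
theorem stmt9 {n t : ℕ} (hn : 1 ≤ n)
    (C : Submodule (ZMod 2) (Fin n → ZMod 2))
    (hdim : Module.finrank (ZMod 2) C = t) :
    ∀ x : Fin n → ZMod 2, x ≠ 0 →
      pr (fun σ : Equiv.Perm (Fin n) => x ∈ permCode σ C) =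
        (Nat.card C : ℝ) * ((wtCount C (wt x) : ℝ) / (Nat.card C : ℝ)) /
          (Nat.choose n (wt x) : ℝ) ∧
      pr (fun σ : Equiv.Perm (Fin n) => x ∈ permCode σ C) ≤
        ((Finset.Icc 1 n).sup' (by simp [Finset.nonempty_Icc]; omega) (fun k => epsK C k)) *
          ((2 : ℝ) ^ t / 2 ^ n) := by
  intro x hx
  have hcard : Nat.card C = 2 ^ t := by
    rw [Module.natCard_eq_pow_finrank (K := ZMod 2), hdim, Nat.card_zmod]
  have hpr := pr_mem_permCode C x
  refine ⟨?_, ?_⟩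
  · rw [hpr, hcard, mul_div_cancel₀]
    positivity
  · have heps : pr (fun σ : Equiv.Perm (Fin n) => x ∈ permCode σ C) =
        epsK C (wt x) * ((2 : ℝ) ^ t / 2 ^ n) := by
      rw [hpr, epsK, hcard]
      push_cast
      field_simp
    rw [heps]
    gcongr
    exact Finset.le_sup' (epsK C) (Finset.mem_Icc.mpr ⟨wt_pos hx, wt_le x⟩)
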